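/- Let F : ℂ³ → ℂ³ be a dominant polynomial mapping of degree 2 with S_F ≠ ∅. Suppose S_F contains a paraboloid H. If Z is the zero set of an irreducible nonconstant polynomial with Z ⊆ S_F and Z ≠ H, then Z is a plane. -/

import Mathlib

open Filter Topology

/-- The asymptotic set of a mapping `F : ℂⁿ → ℂⁿ`. -/
def asymptoticSet {n : ℕ} (F : (Fin n → ℂ) → (Fin n → ℂ)) : Set (Fin n → ℂ) :=
  {a | ∃ ξ : ℕ → (Fin n → ℂ),
    Tendsto (fun k => ‖ξ k‖) atTop atTop ∧ Tendsto (fun k => F (ξ k)) atTop (nhds a)}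

/-- A plane in `ℂ³`: the zero set of a polynomial of total degree 1. -/
def IsPlane (S : Set (Fin 3 → ℂ)) : Prop :=
  ∃ Q : MvPolynomial (Fin 3) ℂ, Q.totalDegree = 1 ∧
    S = {x | MvPolynomial.eval x Q = 0}

/-- A paraboloid in `ℂ³`: the zero set of a polynomial of the form
`r·x_i² + s·x_j + t·x_l + u` where `{i, j, l} = {1, 2, 3}`, `r ≠ 0` and `(s, t) ≠ (0, 0)`. -/
def IsParaboloid (S : Set (Fin 3 → ℂ)) : Prop :=
  ∃ (i j l : Fin 3) (r s t u : ℂ),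
    i ≠ j ∧ j ≠ l ∧ i ≠ l ∧ r ≠ 0 ∧ (s, t) ≠ (0, 0) ∧
    S = {x | r * (x i) ^ 2 + s * x j + t * x l + u = 0}

/-- `F : ℂ³ → ℂ³` is a polynomial mapping of degree 2 with coordinate polynomials `P`. -/
def IsDegTwoPolyMap (P : Fin 3 → MvPolynomial (Fin 3) ℂ)
    (F : (Fin 3 → ℂ) → (Fin 3 → ℂ)) : Prop :=
  (∀ x i, F x i = MvPolynomial.eval x (P i)) ∧
  (∀ i, (P i).totalDegree ≤ 2) ∧ (∃ i, (P i).totalDegree = 2)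

/-- The exponent vectors on three variables of total degree at most `n`. -/
noncomputable def exponentsLE (n : ℕ) : Finset (Fin 3 →₀ ℕ) :=
  (Finset.range (n + 1)).biUnion fun d => Finset.finsuppAntidiag Finset.univ d

lemma mem_exponentsLE {n : ℕ} {α : Fin 3 →₀ ℕ} : α ∈ exponentsLE n ↔ α.degree ≤ n := by
  simp [exponentsLE, Finsupp.degree_eq_sum]

lemma card_exponentsLE (n : ℕ) : (exponentsLE n).card = (n + 3).choose 3 := by
  rw [exponentsLE, Finset.card_biUnion]
  · have : ∀ d, (Finset.finsuppAntidiag (Finset.univ : Finset (Fin 3)) d).card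
        = (d + 2).choose 2 := by
      intro d
      rw [Finset.card_finsuppAntidiag_nat_eq_choose]
      simp only [Finset.card_univ, Fintype.card_fin]
      rw [show 3 + d - 1 = d + 2 by omega, Nat.choose_symm_add]
    simp only [this]
    exact Nat.sum_range_add_choose n 2
  · intro a _ b _ hab
    rw [Function.onFun, Finset.disjoint_left]
    intro f hf hg
    simp only [Finset.mem_finsuppAntidiag] at hf hg
    exact hab (hf.1.symm.trans hg.1)

lemma card_exponentsLE_lt : (exponentsLE (2 * 100 + 8)).card < 9 * (exponentsLE 100).card := by
  rw [card_exponentsLE, card_exponentsLE]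
  decide +kernel

/-- The pairs `(α, b)` whose weight `2 |α| + b` is at most `m`. -/
noncomputable def weightLE (m : ℕ) : Finset ((Fin 3 →₀ ℕ) × ℕ) :=
  (exponentsLE m ×ˢ Finset.range (m + 1)).filter fun p => 2 * p.1.degree + p.2 ≤ m

lemma mem_weightLE {m : ℕ} {p : (Fin 3 →₀ ℕ) × ℕ} :
    p ∈ weightLE m ↔ 2 * p.1.degree + p.2 ≤ m := by
  simp only [weightLE, Finset.mem_filter, Finset.mem_product, mem_exponentsLE, Finset.mem_range]
  omega

lemma card_exponentsLE_le_card_filter (k : ℕ) (β : Fin 3 →₀ ℕ) (N : ℕ)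
    (h : 9 ≤ 2 * β.degree + N) :
    9 * (exponentsLE k).card ≤
      ((weightLE (2 * k + 8)).filter fun p => ¬ (β ≤ p.1 ∧ N ≤ p.2)).card := by
  have h1 := Finset.card_filter_add_card_filter_not (s := weightLE (2 * k + 8))
    (fun p => β ≤ p.1 ∧ N ≤ p.2)
  have h2 := Finset.card_filter_add_card_filter_not (s := weightLE (2 * k + 8))
    (fun p => 2 * p.1.degree + p.2 < 2 * k)
  have h3 : ((weightLE (2 * k + 8)).filter fun p => β ≤ p.1 ∧ N ≤ p.2).card ≤
      ((weightLE (2 * k + 8)).filter fun p => 2 * p.1.degree + p.2 < 2 * k).card := by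
    refine Finset.card_le_card_of_injOn (fun p => (p.1 - β, p.2 - N)) ?_ ?_
    · intro p hp
      simp only [Finset.coe_filter, Set.mem_ofPred_eq, mem_weightLE] at hp ⊢
      have hd : (p.1 - β).degree + β.degree = p.1.degree := by
        rw [← map_add, tsub_add_cancel_of_le hp.2.1]
      omega
    · intro p hp q hq hpq
      simp only [Finset.coe_filter, Set.mem_ofPred_eq, Prod.mk.injEq] at hp hq hpq
      refine Prod.ext ?_ ?_
      · rw [← tsub_add_cancel_of_le hp.2.1, hpq.1, tsub_add_cancel_of_le hq.2.1]
      · omega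
  have h4 : 9 * (exponentsLE k).card ≤
      ((weightLE (2 * k + 8)).filter fun p => ¬ 2 * p.1.degree + p.2 < 2 * k).card := by
    rw [mul_comm, ← Finset.card_range 9, ← Finset.card_product]
    refine Finset.card_le_card_of_injOn (fun p => (p.1, 2 * (k - p.1.degree) + p.2)) ?_ ?_
    · intro p hp
      simp only [Finset.coe_product, Set.mem_prod, Finset.mem_coe, mem_exponentsLE,
        Finset.coe_filter, Set.mem_ofPred_eq, mem_weightLE, Finset.mem_range] at hp ⊢
      omega
    · intro p _ q _ hpq
      simp only [Prod.mk.injEq] at hpq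
      refine Prod.ext hpq.1 ?_
      have := hpq.2
      rw [hpq.1] at this
      omega
  omega

open MvPolynomial in
lemma totalDegree_aeval_monomial_mul_pow_le {K : Type*} [Field K]
    {P : Fin 3 → MvPolynomial (Fin 3) K} (hP : ∀ i, (P i).totalDegree ≤ 2)
    {t : MvPolynomial (Fin 3) K} (ht : t.totalDegree ≤ 1) (α : Fin 3 →₀ ℕ) (b : ℕ) :
    (aeval P (monomial α (1 : K)) * t ^ b).totalDegree ≤ 2 * α.degree + b := by
  refine (totalDegree_mul _ _).trans (add_le_add ?_ ?_)
  · rw [aeval_monomial, map_one, one_mul, Finsupp.prod_fintype _ _ (by simp)]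
    refine (totalDegree_finsetProd _ _).trans ?_
    rw [Finsupp.degree_eq_sum, Finset.mul_sum]
    refine Finset.sum_le_sum fun i _ => (totalDegree_pow _ _).trans ?_
    rw [mul_comm 2]
    exact Nat.mul_le_mul_left _ (hP i)
  · exact (totalDegree_pow _ _).trans (by nlinarith)

open MvPolynomial in
/-- A set of exponents with more elements than the space of polynomials containing the
corresponding products supports a nontrivial algebraic relation. -/
lemma exists_relation_of_card_lt {K : Type*} [Field K]
    {P : Fin 3 → MvPolynomial (Fin 3) K} (hP : ∀ i, (P i).totalDegree ≤ 2)
    {t : MvPolynomial (Fin 3) K} (ht : t.totalDegree ≤ 1)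
    {T : Finset ((Fin 3 →₀ ℕ) × ℕ)} {M : ℕ} (hT : T ⊆ weightLE M)
    (hcard : (exponentsLE M).card < T.card) :
    ∃ G : Polynomial (MvPolynomial (Fin 3) K), G ≠ 0 ∧
      G.eval₂ (aeval P : MvPolynomial (Fin 3) K →ₐ[K] MvPolynomial (Fin 3) K).toRingHom t = 0 ∧
      ∀ α b, (G.coeff b).coeff α ≠ 0 → (α, b) ∈ T := by
  classical
  let W : Submodule K (MvPolynomial (Fin 3) K) := restrictSupport K (exponentsLE M : Set _)
  let v : T → W := fun p => ⟨aeval P (monomial p.1.1 (1 : K)) * t ^ p.1.2, by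
    intro γ hγ
    rw [Finset.mem_coe, mem_exponentsLE]
    refine (le_totalDegree hγ).trans ?_
    exact (totalDegree_aeval_monomial_mul_pow_le hP ht _ _).trans (mem_weightLE.1 (hT p.2))⟩
  have : Module.Finite K W := Module.Finite.of_basis (basisRestrictSupport K _)
  have hW : Module.finrank K W = (exponentsLE M).card := by
    rw [Module.finrank_eq_card_basis
      (basisRestrictSupport K (exponentsLE M : Set (Fin 3 →₀ ℕ)))]
    simp
  have hdep : ¬ LinearIndependent K v := fun h => by
    have := h.fintype_card_le_finrank
    rw [hW, Fintype.card_coe] at this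
    omega
  obtain ⟨g, hg, p₀, hp₀⟩ := Fintype.not_linearIndependent_iff.1 hdep
  let G : Polynomial (MvPolynomial (Fin 3) K) :=
    ∑ p : T, Polynomial.monomial p.1.2 (monomial p.1.1 (g p))
  have hG : ∀ α b, (G.coeff b).coeff α = ∑ p : T, if p.1 = (α, b) then g p else 0 := by
    intro α b
    simp only [G, Polynomial.finsetSum_coeff, coeff_sum, Polynomial.coeff_monomial]
    refine Finset.sum_congr rfl fun p _ => ?_
    rcases p with ⟨⟨a, c⟩, hp⟩
    by_cases h1 : c = b <;> by_cases h2 : a = α <;> simp [h1, h2, coeff_monomial]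
  refine ⟨G, ?_, ?_, ?_⟩
  · intro h0
    apply hp₀
    have := hG p₀.1.1 p₀.1.2
    rw [h0] at this
    simp only [Polynomial.coeff_zero, coeff_zero] at this
    rw [Finset.sum_eq_single p₀] at this
    · simpa using this.symm
    · intro q _ hq
      rw [if_neg]
      exact fun h => hq (Subtype.ext h)
    · simp
  · have h := congrArg (Subtype.val) hg
    simp only [Submodule.coe_sum, Submodule.coe_smul, Submodule.coe_zero, v] at h
    rw [← h]
    simp only [G, Polynomial.eval₂_finsetSum, Polynomial.eval₂_monomial]
    refine Finset.sum_congr rfl fun p _ => ?_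
    rw [← smul_mul_assoc]
    congr 1
    change aeval P _ = _
    rw [← map_smul, smul_monomial, smul_eq_mul, mul_one]
  · intro α b hne
    rw [hG] at hne
    obtain ⟨p, _, hp⟩ := Finset.exists_ne_zero_of_sum_ne_zero hne
    rw [ite_ne_right_iff] at hp
    exact hp.1 ▸ p.2

open MvPolynomial in
/-- For every exponent of weight at least nine there is a nontrivial algebraic relation none of
whose exponents is divisible by it. -/
lemma exists_relation_not_le {K : Type*} [Field K]
    {P : Fin 3 → MvPolynomial (Fin 3) K} (hP : ∀ i, (P i).totalDegree ≤ 2)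
    {t : MvPolynomial (Fin 3) K} (ht : t.totalDegree ≤ 1)
    (β : Fin 3 →₀ ℕ) (N : ℕ) (h : 9 ≤ 2 * β.degree + N) :
    ∃ G : Polynomial (MvPolynomial (Fin 3) K), G ≠ 0 ∧
      G.eval₂ (aeval P : MvPolynomial (Fin 3) K →ₐ[K] MvPolynomial (Fin 3) K).toRingHom t = 0 ∧
      ∀ α b, (G.coeff b).coeff α ≠ 0 → ¬ (β ≤ α ∧ N ≤ b) := by
  have hcard := card_exponentsLE_lt.trans_le (card_exponentsLE_le_card_filter 100 β N h)
  generalize 2 * 100 + 8 = M at hcard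
  obtain ⟨G, hG0, hG, hGT⟩ :=
    exists_relation_of_card_lt hP ht (Finset.filter_subset _ (weightLE M)) hcard
  exact ⟨G, hG0, hG, fun α b hab => (Finset.mem_filter.1 (hGT α b hab)).2⟩

lemma Ideal.IsPrime.exists_prime_dvd_of_mem {A : Type*} [CommRing A] [IsDomain A]
    [UniqueFactorizationMonoid A] {I : Ideal A} (hI : I.IsPrime) {a : A} (ha : a ≠ 0)
    (haI : a ∈ I) : ∃ p, Prime p ∧ p ∈ I ∧ p ∣ a := by
  induction a using UniqueFactorizationMonoid.induction_on_prime with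
  | h₁ => exact absurd rfl ha
  | h₂ u hu => exact absurd (Ideal.eq_top_of_isUnit_mem I haI hu) hI.ne_top
  | h₃ a p ha' hp ih =>
    rcases hI.mem_or_mem haI with h | h
    · exact ⟨p, hp, h, dvd_mul_right _ _⟩
    · obtain ⟨q, hq, hqI, hqa⟩ := ih ha' h
      exact ⟨q, hq, hqI, hqa.mul_left p⟩

/-- A prime of `A[X]` inside a prime ideal meeting `A` trivially generates that ideal as soon as it
has minimal degree. -/
lemma Polynomial.dvd_of_prime_of_minimal_natDegree {A : Type*} [CommRing A] [IsDomain A]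
    {I : Ideal (Polynomial A)} (hIC : ∀ r, Polynomial.C r ∈ I → r = 0)
    {p : Polynomial A} (hp : Prime p) (hpI : p ∈ I)
    (hmin : ∀ G ∈ I, G ≠ 0 → p.natDegree ≤ G.natDegree) {G : Polynomial A} (hG : G ∈ I) :
    p ∣ G := by
  have hpC : ¬ p ∣ Polynomial.C p.leadingCoeff := by
    rintro ⟨q, hq⟩
    have h := I.mul_mem_right q hpI
    rw [← hq] at h
    exact hp.ne_zero (Polynomial.leadingCoeff_eq_zero.1 (hIC _ h))
  induction hn : G.degree using WellFoundedLT.induction generalizing G with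
  | ind n ih =>
    by_cases h0 : G = 0
    · simp [h0]
    have hle := hmin G hG h0
    let G' := Polynomial.C p.leadingCoeff * G -
      Polynomial.C G.leadingCoeff * Polynomial.X ^ (G.natDegree - p.natDegree) * p
    have hG' : G' ∈ I := I.sub_mem (I.mul_mem_left _ hG) (I.mul_mem_left _ hpI)
    have hlp : p.leadingCoeff ≠ 0 := Polynomial.leadingCoeff_ne_zero.2 hp.ne_zero
    have hlG : G.leadingCoeff ≠ 0 := Polynomial.leadingCoeff_ne_zero.2 h0
    have hd : G'.degree < G.degree := by
      have e1 : (Polynomial.C p.leadingCoeff * G).degree = G.degree := by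
        rw [Polynomial.degree_mul, Polynomial.degree_C hlp, zero_add]
      rw [← e1]
      refine Polynomial.degree_sub_lt_left ?_ ?_ ?_
      · rw [e1, Polynomial.degree_mul, Polynomial.degree_C_mul_X_pow _ hlG,
          Polynomial.degree_eq_natDegree h0, Polynomial.degree_eq_natDegree hp.ne_zero]
        norm_cast
        omega
      · exact mul_ne_zero (Polynomial.C_ne_zero.2 hlp) h0
      · rw [Polynomial.leadingCoeff_mul, Polynomial.leadingCoeff_mul, Polynomial.leadingCoeff_C,
          Polynomial.leadingCoeff_C_mul_X_pow, mul_comm]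
    have hdvd : p ∣ G' := ih _ (hn ▸ hd) hG' rfl
    have : p ∣ Polynomial.C p.leadingCoeff * G := by
      have := dvd_add hdvd (Dvd.intro_left
        (Polynomial.C G.leadingCoeff * Polynomial.X ^ (G.natDegree - p.natDegree)) rfl)
      simpa [G'] using this
    exact (hp.dvd_or_dvd this).resolve_left hpC

open MvPolynomial in
/-- Perron-type bound: a polynomial of degree at most one satisfies an algebraic relation over
three algebraically independent polynomials of degree at most two whose leading coefficient has
degree at most three. -/
lemma exists_relation_totalDegree_leadingCoeff_le {K : Type*} [Field K]
    {P : Fin 3 → MvPolynomial (Fin 3) K} (hP : ∀ i, (P i).totalDegree ≤ 2)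
    (hinj : AlgebraicIndependent K P)
    {t : MvPolynomial (Fin 3) K} (ht : t.totalDegree ≤ 1) :
    ∃ G : Polynomial (MvPolynomial (Fin 3) K),
      G.eval₂ (aeval P : MvPolynomial (Fin 3) K →ₐ[K] MvPolynomial (Fin 3) K).toRingHom t = 0 ∧
      0 < G.natDegree ∧ G.leadingCoeff.totalDegree ≤ 3 := by
  classical
  let f := (aeval P : MvPolynomial (Fin 3) K →ₐ[K] MvPolynomial (Fin 3) K).toRingHom
  let I := RingHom.ker (Polynomial.eval₂RingHom f t)
  have hI : I.IsPrime := RingHom.ker_isPrime _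
  have hmemI : ∀ G, G ∈ I ↔ G.eval₂ f t = 0 := fun G => Iff.rfl
  have hf : Function.Injective f := hinj
  have hIC : ∀ r, Polynomial.C r ∈ I → r = 0 := by
    intro r hr
    rw [hmemI, Polynomial.eval₂_C] at hr
    exact (map_eq_zero_iff f hf).1 hr
  have hex : ∃ n, ∃ G ∈ I, G ≠ 0 ∧ G.natDegree = n := by
    obtain ⟨G, hG0, hG, -⟩ := exists_relation_not_le hP ht 0 9 (by simp)
    exact ⟨_, G, hG, hG0, rfl⟩
  obtain ⟨G₀, hG₀I, hG₀, hdeg⟩ := Nat.find_spec hex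
  obtain ⟨p, hp, hpI, hpG⟩ := hI.exists_prime_dvd_of_mem hG₀ hG₀I
  have hmin : ∀ G ∈ I, G ≠ 0 → p.natDegree ≤ G.natDegree := fun G hG hG0 =>
    (Polynomial.natDegree_le_of_dvd hpG hG₀).trans
      (hdeg ▸ Nat.find_min' hex ⟨G, hG, hG0, rfl⟩)
  have hpos : 0 < p.natDegree := by
    by_contra h
    rw [Polynomial.eq_C_of_natDegree_eq_zero (by omega : p.natDegree = 0)] at hp hpI
    rw [hIC _ hpI] at hp
    simp at hp
  refine ⟨p, hpI, hpos, ?_⟩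
  by_contra! hlarge
  set a := p.leadingCoeff with ha
  have ha0 : a ≠ 0 := Polynomial.leadingCoeff_ne_zero.2 hp.ne_zero
  have hw : 9 ≤ 2 * (MonomialOrder.degLex.degree a).degree + p.natDegree := by
    rw [degree_degLexDegree]
    omega
  obtain ⟨G, hG0, hGI, hGT⟩ := exists_relation_not_le hP ht _ _ hw
  obtain ⟨q, rfl⟩ := Polynomial.dvd_of_prime_of_minimal_natDegree hIC hp hpI hmin hGI
  have hq0 : q ≠ 0 := right_ne_zero_of_mul hG0
  have hlc := Polynomial.leadingCoeff_ne_zero.2 hG0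
  refine hGT (MonomialOrder.degLex.degree (p * q).leadingCoeff) (p * q).natDegree
    (MonomialOrder.degLex.coeff_degree_ne_zero_iff.2 hlc) ⟨?_, ?_⟩
  · rw [Polynomial.leadingCoeff_mul, MonomialOrder.degree_mul ha0
      (Polynomial.leadingCoeff_ne_zero.2 hq0)]
    exact le_self_add
  · rw [Polynomial.natDegree_mul hp.ne_zero hq0]
    exact Nat.le_add_right _ _

open MvPolynomial in
lemma eval_aeval_eq {P : Fin 3 → MvPolynomial (Fin 3) ℂ} (x : Fin 3 → ℂ)
    (G : MvPolynomial (Fin 3) ℂ) :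
    eval x (aeval P G) = eval (fun i => eval x (P i)) G := by
  induction G using MvPolynomial.induction_on with
  | C a => simp
  | add p q hp hq => rw [map_add, map_add, map_add, hp, hq]
  | mul_X p i hp => rw [map_mul, map_mul, map_mul, hp, aeval_X, eval_X]

open MvPolynomial in
lemma algebraicIndependent_of_dense_range {P : Fin 3 → MvPolynomial (Fin 3) ℂ}
    {F : (Fin 3 → ℂ) → (Fin 3 → ℂ)} (hF : ∀ x i, F x i = eval x (P i))
    (hdom : Dense (Set.range F)) : AlgebraicIndependent ℂ P := by
  refine (injective_iff_map_eq_zero (aeval (R := ℂ) P)).2 fun G hG => ?_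
  have hcont : Continuous fun y => eval y G := G.continuous_eval
  have h := hcont.ext_on hdom (continuous_const (y := (0 : ℂ))) (by
    rintro _ ⟨x, rfl⟩
    have h := congrArg (eval x) hG
    rw [map_zero, eval_aeval_eq] at h
    rwa [show F x = fun i => eval x (P i) from funext (hF x)])
  exact MvPolynomial.funext fun x => by simpa using congrFun h x

/-- Roots of polynomials with convergent coefficients stay bounded if the limit of the leading
coefficients is nonzero. -/
lemma isBigO_one_of_sum_mul_pow_eq_zero {N : ℕ} {c : ℕ → ℕ → ℂ} {c' : ℕ → ℂ} {z : ℕ → ℂ}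
    (hz : ∀ k, ∑ b ∈ Finset.range (N + 1), c b k * z k ^ b = 0)
    (hc : ∀ b, Tendsto (c b) atTop (𝓝 (c' b))) (hN : c' N ≠ 0) :
    z =O[atTop] fun _ => (1 : ℝ) := by
  have hpos : 0 < ‖c' N‖ := norm_pos_iff.2 hN
  have h1 : ∀ᶠ k in atTop, ∀ b ∈ Finset.range N, ‖c b k‖ ≤ ‖c' b‖ + 1 :=
    (Finset.eventually_all _).2 fun b _ =>
      ((hc b).norm.eventually (ge_mem_nhds (lt_add_one _)))
  have h2 : ∀ᶠ k in atTop, ‖c' N‖ / 2 ≤ ‖c N k‖ :=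
    (hc N).norm.eventually (le_mem_nhds (half_lt_self hpos))
  set B := ∑ b ∈ Finset.range N, (‖c' b‖ + 1) with hB
  refine Asymptotics.IsBigO.of_bound (max 1 (B / (‖c' N‖ / 2))) ?_
  filter_upwards [h1, h2] with k h1 h2
  rw [norm_one, mul_one]
  by_contra! hlt
  obtain ⟨hz1, hzB⟩ := max_lt_iff.1 hlt
  have hle : ‖c N k‖ * ‖z k‖ ^ N ≤ ∑ b ∈ Finset.range N, ‖c b k‖ * ‖z k‖ ^ b := by
    have h := hz k
    rw [Finset.sum_range_succ, add_comm, add_eq_zero_iff_eq_neg] at h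
    rw [← norm_pow, ← norm_mul, h, norm_neg]
    exact (norm_sum_le _ _).trans_eq (Finset.sum_congr rfl fun b _ => by simp)
  cases N with
  | zero =>
    simp only [Finset.range_zero, Finset.sum_empty, pow_zero, mul_one] at hle
    linarith
  | succ n =>
    have hle' : ∑ b ∈ Finset.range (n + 1), ‖c b k‖ * ‖z k‖ ^ b ≤ B * ‖z k‖ ^ n := by
      rw [hB, Finset.sum_mul]
      refine Finset.sum_le_sum fun b hb => mul_le_mul (h1 b hb) ?_ (by positivity) (by positivity)
      exact pow_le_pow_right₀ hz1.le (Nat.lt_succ_iff.1 (Finset.mem_range.1 hb))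
    rw [div_lt_iff₀ (half_pos hpos)] at hzB
    have hzn : 0 < ‖z k‖ ^ n := by positivity
    have h3 : ‖c' (n + 1)‖ / 2 * ‖z k‖ ^ (n + 1) ≤ ‖c (n + 1) k‖ * ‖z k‖ ^ (n + 1) := by gcongr
    have h4 : B * ‖z k‖ ^ n < ‖z k‖ * (‖c' (n + 1)‖ / 2) * ‖z k‖ ^ n := by gcongr
    rw [pow_succ] at h3 hle
    nlinarith

open MvPolynomial in
lemma isBigO_one_of_relation {P : Fin 3 → MvPolynomial (Fin 3) ℂ}
    {F : (Fin 3 → ℂ) → (Fin 3 → ℂ)} (hF : ∀ x i, F x i = eval x (P i))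
    {t : MvPolynomial (Fin 3) ℂ} {G : Polynomial (MvPolynomial (Fin 3) ℂ)}
    (hG : G.eval₂ (aeval P : MvPolynomial (Fin 3) ℂ →ₐ[ℂ] MvPolynomial (Fin 3) ℂ).toRingHom t = 0)
    {ξ : ℕ → Fin 3 → ℂ} {a : Fin 3 → ℂ} (hξ : Tendsto (fun k => F (ξ k)) atTop (𝓝 a))
    (ha : eval a G.leadingCoeff ≠ 0) :
    (fun k => eval (ξ k) t) =O[atTop] fun _ => (1 : ℝ) := by
  refine isBigO_one_of_sum_mul_pow_eq_zero (N := G.natDegree)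
    (c := fun b k => eval (F (ξ k)) (G.coeff b)) (c' := fun b => eval a (G.coeff b)) ?_ ?_ ha
  · intro k
    have h := congrArg (eval (ξ k)) hG
    rw [Polynomial.eval₂_eq_sum_range, map_zero, map_sum] at h
    rw [← h]
    refine Finset.sum_congr rfl fun b _ => ?_
    rw [map_mul, map_pow]
    congr 1
    change _ = eval (ξ k) (aeval P (G.coeff b))
    rw [eval_aeval_eq, show F (ξ k) = fun i => eval (ξ k) (P i) from funext (hF _)]
  · intro b
    exact ((G.coeff b).continuous_eval.tendsto a).comp hξ

/-- Bounded values at three points of the quadratic with coefficients `x 0, x 1, x 2` force these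
coefficients to be bounded. -/
lemma isBigO_one_of_quadratic {x : ℕ → Fin 3 → ℂ} {s₁ s₂ s₃ : ℂ} (h12 : s₁ ≠ s₂) (h13 : s₁ ≠ s₃)
    (h23 : s₂ ≠ s₃)
    (h₁ : (fun k => x k 0 + s₁ * x k 1 + s₁ ^ 2 * x k 2) =O[atTop] fun _ => (1 : ℝ))
    (h₂ : (fun k => x k 0 + s₂ * x k 1 + s₂ ^ 2 * x k 2) =O[atTop] fun _ => (1 : ℝ))
    (h₃ : (fun k => x k 0 + s₃ * x k 1 + s₃ ^ 2 * x k 2) =O[atTop] fun _ => (1 : ℝ)) :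
    x =O[atTop] fun _ => (1 : ℝ) := by
  have e12 := sub_ne_zero.2 h12
  have e13 := sub_ne_zero.2 h13
  have e23 := sub_ne_zero.2 h23
  have d12 := (h₁.sub h₂).const_mul_left (s₁ - s₂)⁻¹
  have d13 := (h₁.sub h₃).const_mul_left (s₁ - s₃)⁻¹
  have hx2 : (fun k => x k 2) =O[atTop] fun _ => (1 : ℝ) := by
    refine ((d12.sub d13).const_mul_left (s₂ - s₃)⁻¹).congr_left fun k => ?_
    field_simp
    ring
  have hx1 : (fun k => x k 1) =O[atTop] fun _ => (1 : ℝ) := by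
    refine (d12.sub (hx2.const_mul_left (s₁ + s₂))).congr_left fun k => ?_
    field_simp
    ring
  have hx0 : (fun k => x k 0) =O[atTop] fun _ => (1 : ℝ) := by
    refine ((h₁.sub (hx1.const_mul_left s₁)).sub (hx2.const_mul_left (s₁ ^ 2))).congr_left
      fun k => ?_
    ring
  rw [Asymptotics.isBigO_pi]
  intro i
  fin_cases i
  exacts [hx0, hx1, hx2]

open MvPolynomial in
/-- On the asymptotic set, at most two linear forms `X₀ + s X₁ + s² X₂` admit a relation whose
leading coefficient does not vanish. -/
lemma eval_mul_leadingCoeff_eq_zero {P : Fin 3 → MvPolynomial (Fin 3) ℂ}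
    {F : (Fin 3 → ℂ) → (Fin 3 → ℂ)} (hF : ∀ x i, F x i = eval x (P i))
    {ι : Type*} {s : ι → ℂ} (hs : Function.Injective s)
    {G : ι → Polynomial (MvPolynomial (Fin 3) ℂ)}
    (hG : ∀ i, (G i).eval₂
      (aeval P : MvPolynomial (Fin 3) ℂ →ₐ[ℂ] MvPolynomial (Fin 3) ℂ).toRingHom
      (X 0 + C (s i) * X 1 + C (s i ^ 2) * X 2) = 0)
    {i j l : ι} (hij : i ≠ j) (hil : i ≠ l) (hjl : j ≠ l)
    {a : Fin 3 → ℂ} (ha : a ∈ asymptoticSet F) :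
    eval a ((G i).leadingCoeff * (G j).leadingCoeff * (G l).leadingCoeff) = 0 := by
  obtain ⟨ξ, hξ, hFξ⟩ := ha
  by_contra hne
  simp only [map_mul, mul_ne_zero_iff, ← ne_eq] at hne
  have hb : ∀ m, eval a (G m).leadingCoeff ≠ 0 →
      (fun k => ξ k 0 + s m * ξ k 1 + s m ^ 2 * ξ k 2) =O[atTop] fun _ => (1 : ℝ) := by
    intro m hm
    simpa using isBigO_one_of_relation hF (hG m) hFξ hm
  have h := isBigO_one_of_quadratic (hs.ne hij) (hs.ne hil) (hs.ne hjl)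
    (hb i hne.1.1) (hb j hne.1.2) (hb l hne.2)
  exact not_isBoundedUnder_of_tendsto_atTop hξ ((Asymptotics.isBigO_one_iff ℝ).1 h)

open MvPolynomial in
/-- A paraboloid is the zero set of a prime polynomial of degree at least two that divides every
polynomial vanishing on it. -/
lemma IsParaboloid.exists_prime {H : Set (Fin 3 → ℂ)} (hH : IsParaboloid H) :
    ∃ h : MvPolynomial (Fin 3) ℂ, Prime h ∧ 2 ≤ h.totalDegree ∧ H = {x | eval x h = 0} ∧
      ∀ G : MvPolynomial (Fin 3) ℂ, (∀ x ∈ H, eval x G = 0) → h ∣ G := by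
  classical
  obtain ⟨i, j, l, r, s, t, u, hij, hjl, hil, hr, hst, rfl⟩ := hH
  wlog hs : s ≠ 0 generalizing j l s t
  · push Not at hs
    subst hs
    have ht : t ≠ 0 := by rintro rfl; exact hst rfl
    obtain ⟨h, h1, h2, h3, h4⟩ :=
      this l j t 0 hil hjl.symm hij (by simp [ht]) ht
    have e : {x : Fin 3 → ℂ | r * x i ^ 2 + 0 * x j + t * x l + u = 0} =
        {x | r * x i ^ 2 + t * x l + 0 * x j + u = 0} := by
      ext x
      simp
    exact ⟨h, h1, h2, e ▸ h3, e ▸ h4⟩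
  let h : MvPolynomial (Fin 3) ℂ := C r * X i ^ 2 + C s * X j + C t * X l + C u
  let g : MvPolynomial (Fin 3) ℂ := C (-s⁻¹) * (C r * X i ^ 2 + C t * X l + C u)
  let σ : MvPolynomial (Fin 3) ℂ →ₐ[ℂ] MvPolynomial (Fin 3) ℂ :=
    aeval fun k => if k = j then g else X k
  have hσh : σ h = 0 := by
    have hC : (C s : MvPolynomial (Fin 3) ℂ) * C (-s⁻¹) = -1 := by
      rw [← C_mul, mul_neg, mul_inv_cancel₀ hs, C_neg, C_1]
    simp only [σ, h, map_add, map_mul, map_pow, aeval_X, algHom_C, algebraMap_eq, if_neg hij,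
      if_neg hjl.symm, if_true, g]
    linear_combination (C r * X i ^ 2 + C t * X l + C u) * hC
  have hdvd : ∀ G, σ G = 0 → h ∣ G := by
    intro G hG
    have hq : ((Ideal.Quotient.mkₐ ℂ (Ideal.span {h})).comp σ) =
        Ideal.Quotient.mkₐ ℂ (Ideal.span {h}) := by
      refine MvPolynomial.algHom_ext fun k => ?_
      by_cases hk : k = j
      · subst hk
        simp only [AlgHom.comp_apply, σ, aeval_X, if_true, Ideal.Quotient.mkₐ_eq_mk]
        rw [Ideal.Quotient.eq, Ideal.mem_span_singleton]
        refine ⟨C (-s⁻¹), ?_⟩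
        have hC : (C s : MvPolynomial (Fin 3) ℂ) * C (-s⁻¹) = -1 := by
          rw [← C_mul, mul_neg, mul_inv_cancel₀ hs, C_neg, C_1]
        simp only [g, h]
        linear_combination (-X k) * hC
      · simp [σ, hk]
    have := DFunLike.congr_fun hq G
    rw [AlgHom.comp_apply, hG, map_zero, Ideal.Quotient.mkₐ_eq_mk, eq_comm,
      Ideal.Quotient.eq_zero_iff_mem, Ideal.mem_span_singleton] at this
    exact this
  have hcoeff : h.coeff (Finsupp.single i 2) = r := by
    have h1 : Finsupp.single j 1 ≠ Finsupp.single i 2 := by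
      simp [Finsupp.single_eq_single_iff]
    have h2 : Finsupp.single l 1 ≠ Finsupp.single i 2 := by
      simp [Finsupp.single_eq_single_iff]
    have h3 : (0 : Fin 3 →₀ ℕ) ≠ Finsupp.single i 2 := by
      simp [eq_comm]
    simp [h, coeff_C_mul, coeff_X_pow, coeff_X, h1, h2, h3, coeff_C]
  have hset : {x : Fin 3 → ℂ | r * x i ^ 2 + s * x j + t * x l + u = 0} =
      {x | eval x h = 0} := by
    ext x
    simp [h]
  refine ⟨h, ⟨?_, ?_, ?_⟩, ?_, hset, ?_⟩
  · intro h0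
    rw [h0, coeff_zero] at hcoeff
    exact hr hcoeff.symm
  · intro hu
    have := hu.map σ
    rw [hσh] at this
    exact not_isUnit_zero this
  · rintro a b ⟨c, hc⟩
    have : σ a * σ b = 0 := by rw [← map_mul, hc, map_mul, hσh, zero_mul]
    exact (mul_eq_zero.1 this).imp (hdvd a) (hdvd b)
  · have := le_totalDegree (p := h) (s := Finsupp.single i 2) (by
      rw [mem_support_iff, hcoeff]
      exact hr)
    simpa using this
  · intro G hG
    rw [hset] at hG
    refine hdvd G (MvPolynomial.funext fun x => ?_)
    rw [map_zero, eval_aeval_eq]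
    refine hG _ ?_
    rw [Set.mem_ofPred_eq, ← eval_aeval_eq]
    change eval x (σ h) = 0
    rw [hσh, map_zero]

open MvPolynomial in
lemma Irreducible.dvd_of_vanishes {Q : MvPolynomial (Fin 3) ℂ} (hQ : Irreducible Q)
    {G : MvPolynomial (Fin 3) ℂ} (hG : ∀ x, eval x Q = 0 → eval x G = 0) : Q ∣ G := by
  have hprime : (Ideal.span {Q}).IsPrime :=
    (Ideal.span_singleton_prime hQ.ne_zero).2 hQ.prime
  rw [← Ideal.mem_span_singleton,
    ← MvPolynomial.IsPrime.vanishingIdeal_zeroLocus (K := ℂ) (Ideal.span {Q}),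
    mem_vanishingIdeal_iff]
  intro x hx
  simpa using hG x (by simpa using hx Q (Ideal.mem_span_singleton_self Q))

/-- If a prime divides each product of three factors with distinct indices, it fails to divide at
most two of the factors. -/
lemma Prime.card_filter_not_dvd_le {A ι : Type*} [CommRing A] [Fintype ι] {p : A}
    (hp : Prime p) (a : ι → A) [DecidablePred fun i => ¬ p ∣ a i]
    (h : ∀ i j l, i ≠ j → i ≠ l → j ≠ l → p ∣ a i * a j * a l) :
    (Finset.univ.filter fun i => ¬ p ∣ a i).card ≤ 2 := by
  by_contra! hlt
  obtain ⟨i, j, l, hi, hj, hl, hij, hil, hjl⟩ := Finset.two_lt_card_iff.1 hlt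
  simp only [Finset.mem_filter, Finset.mem_univ, true_and] at hi hj hl
  rcases hp.dvd_or_dvd (h i j l hij hil hjl) with h' | h'
  · exact (hp.dvd_or_dvd h').elim hi hj
  · exact hl h'

/-- If `S_F` contains a paraboloid `H`, then every other irreducible hypersurface contained
in `S_F` is a plane. -/
theorem other_component_is_plane
    (P : Fin 3 → MvPolynomial (Fin 3) ℂ) (F : (Fin 3 → ℂ) → (Fin 3 → ℂ))
    (hP : IsDegTwoPolyMap P F)
    (hdom : Dense (Set.range F))
    (hne : asymptoticSet F ≠ ∅)
    (H : Set (Fin 3 → ℂ)) (hH : IsParaboloid H) (hHsub : H ⊆ asymptoticSet F)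
    (Q : MvPolynomial (Fin 3) ℂ) (hQirr : Irreducible Q) (hQdeg : 0 < Q.totalDegree)
    (Z : Set (Fin 3 → ℂ)) (hZ : Z = {x | MvPolynomial.eval x Q = 0})
    (hZsub : Z ⊆ asymptoticSet F) (hZH : Z ≠ H) :
    IsPlane Z := by
  classical
  obtain ⟨hF, hdeg, -⟩ := hP
  obtain ⟨h, hh, hh2, hHh, hdvd⟩ := hH.exists_prime
  have hinj := algebraicIndependent_of_dense_range hF hdom
  let s : Fin 5 → ℂ := fun m => (m : ℕ)
  have hs : Function.Injective s := fun a b hab => Fin.ext (Nat.cast_injective hab)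
  have hrel : ∀ m, ∃ G : Polynomial (MvPolynomial (Fin 3) ℂ), G.eval₂
      (MvPolynomial.aeval P : MvPolynomial (Fin 3) ℂ →ₐ[ℂ] MvPolynomial (Fin 3) ℂ).toRingHom
      (MvPolynomial.X 0 + MvPolynomial.C (s m) * MvPolynomial.X 1 +
        MvPolynomial.C (s m ^ 2) * MvPolynomial.X 2) = 0 ∧
      0 < G.natDegree ∧ G.leadingCoeff.totalDegree ≤ 3 := by
    intro m
    have hX : ∀ (c : ℂ) (i : Fin 3),
        (MvPolynomial.C c * MvPolynomial.X i : MvPolynomial (Fin 3) ℂ).totalDegree ≤ 1 :=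
      fun c i => (MvPolynomial.totalDegree_mul _ _).trans (by simp)
    refine exists_relation_totalDegree_leadingCoeff_le hdeg hinj ?_
    refine (MvPolynomial.totalDegree_add _ _).trans (max_le ?_ (hX _ _))
    exact (MvPolynomial.totalDegree_add _ _).trans (max_le (by simp) (hX _ _))
  choose G hG hGpos hGdeg using hrel
  have hvan : ∀ i j l, i ≠ j → i ≠ l → j ≠ l → ∀ a ∈ asymptoticSet F,
      MvPolynomial.eval a ((G i).leadingCoeff * (G j).leadingCoeff * (G l).leadingCoeff) = 0 :=
    fun i j l hij hil hjl a ha => eval_mul_leadingCoeff_eq_zero hF hs hG hij hil hjl ha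
  have hbadH := hh.card_filter_not_dvd_le (fun m => (G m).leadingCoeff)
    fun i j l hij hil hjl => hdvd _ fun x hx => hvan i j l hij hil hjl x (hHsub hx)
  have hbadZ := hQirr.prime.card_filter_not_dvd_le (fun m => (G m).leadingCoeff)
    fun i j l hij hil hjl => hQirr.dvd_of_vanishes fun x hx =>
      hvan i j l hij hil hjl x (hZsub (hZ ▸ hx))
  obtain ⟨m, hm⟩ : ∃ m, h ∣ (G m).leadingCoeff ∧ Q ∣ (G m).leadingCoeff := by
    by_contra! hall
    have hle := Finset.card_le_card (s := (Finset.univ : Finset (Fin 5)))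
      (t := (Finset.univ.filter fun m => ¬ h ∣ (G m).leadingCoeff) ∪
        Finset.univ.filter fun m => ¬ Q ∣ (G m).leadingCoeff) fun m _ => by
      by_cases h1 : h ∣ (G m).leadingCoeff
      · simp [hall m h1]
      · simp [h1]
    have := hle.trans (Finset.card_union_le _ _)
    rw [Finset.card_univ, Fintype.card_fin] at this
    omega
  obtain ⟨hhG, c, hc⟩ := hm
  have hnot : ¬ h ∣ Q := by
    intro hdiv
    obtain ⟨k, hk⟩ := (hh.irreducible.dvd_symm hQirr hdiv)
    obtain ⟨k', hk'⟩ := hdiv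
    apply hZH
    rw [hZ, hHh]
    ext x
    simp only [Set.mem_ofPred_eq]
    constructor
    · intro hx
      rw [hk, map_mul, hx, zero_mul]
    · intro hx
      rw [hk', map_mul, hx, zero_mul]
  have hne0 : (G m).leadingCoeff ≠ 0 := by
    rw [Polynomial.leadingCoeff_ne_zero]
    intro h0
    have := hGpos m
    rw [h0] at this
    simp at this
  obtain ⟨d, rfl⟩ := (hh.dvd_or_dvd (hc ▸ hhG)).resolve_left hnot
  have hdeg3 := hGdeg m
  rw [hc] at hne0 hdeg3
  have hd0 := right_ne_zero_of_mul hne0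
  rw [MvPolynomial.totalDegree_mul_of_isDomain hQirr.ne_zero hd0,
    MvPolynomial.totalDegree_mul_of_isDomain hh.ne_zero (right_ne_zero_of_mul hd0)] at hdeg3
  exact ⟨Q, by omega, hZ⟩
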